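/- Let X ⊆ ℝ^m be a semilinear set such that Z = fcl(X) is a flat with dim(Z) = dim(X) = d, let ℰ = {H₁,…,H_ℓ} be an essential approximation of X, and let {P_J : J ⊆ [ℓ]} be the induced partition of Z. Then for every J ⊆ [ℓ]: (a) either dim(P_J) = d or dim(P_J) ≤ d − 2; (b) either dim(P_J ∩ X) ≤ d − 1 or dim(P_J ∖ X) ≤ d − 1. -/

import Mathlib

open Classical

/-- A basic semilinear set: the solution set of a finite system of linear
equations and (strict or weak) linear inequalities with real coefficients. -/
def IsBasicSemilinear {E : Type*} [AddCommGroup E] [Module ℝ E] (S : Set E) : Prop :=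
  ∃ (k : ℕ) (f : Fin k → E →ₗ[ℝ] ℝ) (c : Fin k → ℝ) (rel : Fin k → ℝ → ℝ → Prop),
    (∀ i, rel i = (· = ·) ∨ rel i = (· < ·) ∨ rel i = (· ≤ ·)) ∧
    S = {x | ∀ i, rel i (f i x) (c i)}

/-- A semilinear set: a finite union of basic semilinear sets. -/
def IsSemilinear {E : Type*} [AddCommGroup E] [Module ℝ E] (S : Set E) : Prop :=
  ∃ (N : ℕ) (T : Fin N → Set E), (∀ j, IsBasicSemilinear (T j)) ∧ S = ⋃ j, T j

/-- A flat: the solution set of a finite system of linear equations. -/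
def IsFlat {E : Type*} [AddCommGroup E] [Module ℝ E] (Z : Set E) : Prop :=
  ∃ (k : ℕ) (f : Fin k → E →ₗ[ℝ] ℝ) (c : Fin k → ℝ), Z = {x | ∀ i, f i x = c i}

/-- A closed set in the flat topology: a finite union of flats. -/
def IsFlatClosed {E : Type*} [AddCommGroup E] [Module ℝ E] (C : Set E) : Prop :=
  ∃ (N : ℕ) (Z : Fin N → Set E), (∀ j, IsFlat (Z j)) ∧ C = ⋃ j, Z j

/-- The closure of `X` in the flat topology. -/
def fcl {E : Type*} [AddCommGroup E] [Module ℝ E] (X : Set E) : Set E :=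
  ⋂₀ {C | IsFlatClosed C ∧ X ⊆ C}

/-- The o-minimal dimension of `X ⊆ ℝ^m`: the largest `d` such that the image
of `X` under some coordinate projection `ℝ^m → ℝ^d` has nonempty interior,
with `dim ∅ = ⊥ (= −∞)`. -/
noncomputable def sldim {m : ℕ} (X : Set (Fin m → ℝ)) : WithBot ℤ :=
  if X = ∅ then ⊥ else
    (((sSup {d : ℕ | ∃ s : Fin d → Fin m, Function.Injective s ∧
      (interior ((fun x (j : Fin d) => x (s j)) '' X)).Nonempty} : ℕ) : ℤ) : WithBot ℤ)

/-- The local dimension of `X` at `a`: the infimum of `dim (U ∩ X)` over open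
neighborhoods `U` of `a`. -/
noncomputable def sldimAt {m : ℕ} (X : Set (Fin m → ℝ)) (a : Fin m → ℝ) : WithBot ℤ :=
  sInf {n : WithBot ℤ | ∃ U : Set (Fin m → ℝ), IsOpen U ∧ a ∈ U ∧ n = sldim (U ∩ X)}

/-- The open cube centered at `a` of half side length `r`. -/
def cube {m : ℕ} (a : Fin m → ℝ) (r : ℝ) : Set (Fin m → ℝ) :=
  {x | ∀ j, |x j - a j| < r}

/-- The boundary of `X` relative to the flat `Z`: points of `Z` every open
cube around which meets both `X` and `Z ∖ X`. -/
def bdIn {m : ℕ} (Z X : Set (Fin m → ℝ)) : Set (Fin m → ℝ) :=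
  {a | a ∈ Z ∧ ∀ r : ℝ, 0 < r →
    (cube a r ∩ X).Nonempty ∧ (cube a r ∩ (Z \ X)).Nonempty}

/-- The essential boundary of `X` relative to the flat `Z`: points `a ∈ Z`
with `dim_a(Z ∩ X) = dim_a(Z ∖ X) = dim_a(Z) = dim Z`. -/
def esbIn {m : ℕ} (Z X : Set (Fin m → ℝ)) : Set (Fin m → ℝ) :=
  {a | a ∈ Z ∧ sldimAt (Z ∩ X) a = sldim Z ∧ sldimAt (Z \ X) a = sldim Z ∧
    sldimAt Z a = sldim Z}

/-- A half-flat of the flat `Z`: a nonempty proper subset of `Z` of the form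
`{a ∈ Z : λ(a) < c}` or `{a ∈ Z : λ(a) ≤ c}`. -/
def IsHalfFlatOf {E : Type*} [AddCommGroup E] [Module ℝ E] (Z H : Set E) : Prop :=
  H.Nonempty ∧ H ≠ Z ∧ ∃ (f : E →ₗ[ℝ] ℝ) (c : ℝ),
    H = {a ∈ Z | f a < c} ∨ H = {a ∈ Z | f a ≤ c}

/-- A closed half-flat of the flat `Z`. -/
def IsClosedHalfFlatOf {E : Type*} [AddCommGroup E] [Module ℝ E] (Z H : Set E) : Prop :=
  H.Nonempty ∧ H ≠ Z ∧ ∃ (f : E →ₗ[ℝ] ℝ) (c : ℝ), H = {a ∈ Z | f a ≤ c}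

/-- `a` witnesses that the half-flat `H ⊆ Z` is essential for `X`:
`a ∈ bd(H)` and some open cube `C` centered at `a` has `X ∩ C = H ∩ C`. -/
def WitnessEssential {m : ℕ} (Z X H : Set (Fin m → ℝ)) (a : Fin m → ℝ) : Prop :=
  a ∈ bdIn Z H ∧ ∃ r : ℝ, 0 < r ∧ X ∩ cube a r = H ∩ cube a r

/-- The half-flat `H ⊆ Z` is essential for `X`. -/
def EssentialFor {m : ℕ} (Z X H : Set (Fin m → ℝ)) : Prop :=
  ∃ a, WitnessEssential Z X H a

/-- An essential approximation of `X` (relative to the flat `Z = fcl X`):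
a list of half-flats of `Z`, each essential for `X`, whose boundaries are
pairwise distinct and realize the boundary of every half-flat essential
for `X`. -/
def IsEssentialApprox {m : ℕ} (Z X : Set (Fin m → ℝ)) {ℓ : ℕ}
    (H : Fin ℓ → Set (Fin m → ℝ)) : Prop :=
  (∀ i, IsHalfFlatOf Z (H i) ∧ EssentialFor Z X (H i)) ∧
  (∀ H' : Set (Fin m → ℝ), IsHalfFlatOf Z H' → EssentialFor Z X H' →
    ∃ i, bdIn Z H' = bdIn Z (H i)) ∧
  (∀ i j, i ≠ j → bdIn Z (H i) ≠ bdIn Z (H j))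

/-- The piece `P_J = (∩_{j ∈ J} H j) ∩ (∩_{j ∉ J} Z ∖ H j)` of the partition
of `Z` induced by the half-flats `H 1, …, H ℓ`. -/
def partPiece {m ℓ : ℕ} (Z : Set (Fin m → ℝ)) (H : Fin ℓ → Set (Fin m → ℝ))
    (J : Set (Fin ℓ)) : Set (Fin m → ℝ) :=
  {a | a ∈ Z ∧ ∀ i, (i ∈ J ↔ a ∈ H i)}

open Filter Topology

section Dimension

variable {m : ℕ}

lemma cube_eq_ball (a : Fin m → ℝ) {r : ℝ} (hr : 0 < r) : cube a r = Metric.ball a r := by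
  ext x
  simp [cube, dist_pi_lt_iff hr, Real.dist_eq]

lemma cube_mem_nhds (a : Fin m → ℝ) {r : ℝ} (hr : 0 < r) : cube a r ∈ 𝓝 a :=
  cube_eq_ball a hr ▸ Metric.ball_mem_nhds a hr

lemma exists_cube_subset {a : Fin m → ℝ} {s : Set (Fin m → ℝ)} (hs : s ∈ 𝓝 a) :
    ∃ r : ℝ, 0 < r ∧ cube a r ⊆ s := by
  obtain ⟨r, hr, h⟩ := Metric.mem_nhds_iff.1 hs
  exact ⟨r, hr, cube_eq_ball a hr ▸ h⟩

/-- A set covered by finitely many sets lying in affine subspaces of dimension at most `n` has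
dimension at most `n`. -/
lemma sldim_le_of_subset_iUnion {ι : Type*} [Finite ι] {S : Set (Fin m → ℝ)}
    {A : ι → Set (Fin m → ℝ)} {n : ℤ} (hS : S ⊆ ⋃ i, A i)
    (hA : ∀ i, ∀ a ∈ A i, ∃ W : Submodule ℝ (Fin m → ℝ), (Module.finrank ℝ W : ℤ) ≤ n ∧
      ∀ x ∈ A i, x - a ∈ W) :
    sldim S ≤ (n : WithBot ℤ) := by
  unfold sldim
  split_ifs with hne
  · exact bot_le
  obtain ⟨x, hx⟩ := Set.nonempty_iff_ne_empty.2 hne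
  obtain ⟨i, hi⟩ := Set.mem_iUnion.1 (hS hx)
  obtain ⟨W, hW, -⟩ := hA i x hi
  lift n to ℕ using (Int.natCast_nonneg _).trans hW with k
  rw [WithBot.coe_le_coe, Int.ofNat_le]
  refine csSup_le' ?_
  rintro e ⟨s, -, hs⟩
  by_contra! hke
  let L : (Fin m → ℝ) →ₗ[ℝ] (Fin e → ℝ) := LinearMap.funLeft ℝ ℝ s
  have hnull : ∀ i, MeasureTheory.volume (L '' A i) = 0 := by
    intro i
    rcases (A i).eq_empty_or_nonempty with h | ⟨a, ha⟩
    · simp [h]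
    obtain ⟨W, hW, hAW⟩ := hA i a ha
    refine MeasureTheory.measure_mono_null (t := (AffineSubspace.mk' (L a) (W.map L) : Set _)) ?_
      (MeasureTheory.Measure.addHaar_affineSubspace _ _ ?_)
    · rintro _ ⟨x, hx, rfl⟩
      simp only [SetLike.mem_coe, AffineSubspace.mem_mk', vsub_eq_sub, ← map_sub]
      exact Submodule.mem_map_of_mem (hAW x hx)
    · intro htop
      have h1 : W.map L = ⊤ := by
        rw [← AffineSubspace.direction_mk' (L a) (W.map L), htop, AffineSubspace.direction_top]
      have h2 := Submodule.finrank_map_le L W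
      rw [h1, finrank_top, Module.finrank_fin_fun] at h2
      omega
  have h0 : MeasureTheory.volume (L '' S) = 0 := by
    refine MeasureTheory.measure_mono_null ?_ (MeasureTheory.measure_iUnion_null hnull)
    rw [← Set.image_iUnion]
    exact Set.image_mono hS
  have h1 : MeasureTheory.volume (interior (L '' S)) = 0 :=
    MeasureTheory.measure_mono_null interior_subset h0
  exact (isOpen_interior.measure_pos MeasureTheory.volume hs).ne' h1

/-- The restriction to a subspace `V` of some projection to `dim V` coordinates is surjective. -/
lemma exists_coordinates_surjective (V : Submodule ℝ (Fin m → ℝ)) :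
    ∃ s : Fin (Module.finrank ℝ V) → Fin m, Function.Injective s ∧
      Function.Surjective ((LinearMap.funLeft ℝ ℝ s).comp V.subtype) := by
  let φ : Fin m → Module.Dual ℝ V := fun j => (LinearMap.proj j).comp V.subtype
  obtain ⟨κ, a, ha, hspan, hli⟩ := exists_linearIndependent' ℝ φ
  have : Finite κ := Finite.of_injective a ha
  have := Fintype.ofFinite κ
  have hinj : Function.Injective ((LinearMap.funLeft ℝ ℝ a).comp V.subtype) := by
    rw [← LinearMap.ker_eq_bot, LinearMap.ker_eq_bot']
    intro v hv
    have hle : Submodule.span ℝ (Set.range (φ ∘ a)) ≤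
        LinearMap.ker (Module.Dual.eval ℝ V v) := by
      rw [Submodule.span_le]
      rintro _ ⟨k, rfl⟩
      exact congrFun hv k
    ext j
    have : φ j ∈ Submodule.span ℝ (Set.range (φ ∘ a)) :=
      hspan ▸ Submodule.subset_span ⟨j, rfl⟩
    exact hle this
  have hcard : Fintype.card κ = Module.finrank ℝ V := by
    apply le_antisymm
    · rw [← Subspace.dual_finrank_eq]
      exact hli.fintype_card_le_finrank
    · simpa using LinearMap.finrank_le_finrank_of_injective hinj
  let e : Fin (Module.finrank ℝ V) ≃ κ := (Fintype.equivFinOfCardEq hcard).symm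
  refine ⟨a ∘ e, ha.comp e.injective, ?_⟩
  rw [← LinearMap.injective_iff_surjective_of_finrank_eq_finrank (by simp)]
  intro v w hvw
  apply hinj
  ext k
  simpa using congrFun hvw (e.symm k)

/-- A set containing a relative neighbourhood of a point in an affine subspace with direction `V`
has dimension at least `dim V`. -/
lemma finrank_le_sldim {V : Submodule ℝ (Fin m → ℝ)} {S : Set (Fin m → ℝ)} {a : Fin m → ℝ}
    (hS : ∀ᶠ x in 𝓝 a, x - a ∈ V → x ∈ S) :
    (((Module.finrank ℝ V : ℕ) : ℤ) : WithBot ℤ) ≤ sldim S := by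
  have haS : a ∈ S := hS.self_of_nhds (by simp)
  unfold sldim
  rw [if_neg (Set.nonempty_iff_ne_empty.1 ⟨a, haS⟩), WithBot.coe_le_coe, Int.ofNat_le]
  obtain ⟨s, hs, hsurj⟩ := exists_coordinates_surjective V
  refine le_csSup ⟨m, ?_⟩ ⟨s, hs, ?_⟩
  · rintro e ⟨t, ht, -⟩
    simpa using Fintype.card_le_of_injective t ht
  let L := (LinearMap.funLeft ℝ ℝ s).comp V.subtype
  have hopen : IsOpenMap fun v : V => (fun j => a (s j)) + L v :=
    (Homeomorph.addLeft _).isOpenMap.comp (L.isOpenMap_of_finiteDimensional hsurj)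
  have hU : {v : V | a + v ∈ S} ∈ 𝓝 (0 : V) := by
    have hc : Tendsto (fun v : V => a + (v : Fin m → ℝ)) (𝓝 0) (𝓝 a) :=
      Continuous.tendsto' (by fun_prop) _ _ (by simp)
    filter_upwards [hc.eventually hS] with v hv
    exact hv (by simp)
  refine ⟨_, mem_interior_iff_mem_nhds.2 (mem_of_superset (hopen.image_mem_nhds hU) ?_)⟩
  rintro _ ⟨v, hv, rfl⟩
  exact ⟨a + v, hv, rfl⟩

end Dimension

section Flat

variable {m : ℕ} {Z : Set (Fin m → ℝ)} {V : Submodule ℝ (Fin m → ℝ)}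

/-- `V` is the direction of the flat `Z`. -/
def HasDirection (Z : Set (Fin m → ℝ)) (V : Submodule ℝ (Fin m → ℝ)) : Prop :=
  ∀ a ∈ Z, ∀ x, x ∈ Z ↔ x - a ∈ V

lemma IsFlat.exists_hasDirection (hZ : IsFlat Z) : ∃ V, HasDirection Z V := by
  obtain ⟨k, f, c, rfl⟩ := hZ
  refine ⟨⨅ i, LinearMap.ker (f i), fun a ha x => ?_⟩
  simp only [Submodule.mem_iInf, LinearMap.mem_ker, map_sub, sub_eq_zero]
  exact forall_congr' fun i => by rw [ha i]

lemma HasDirection.add_smul_mem (hV : HasDirection Z V) {a v : Fin m → ℝ} (ha : a ∈ Z)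
    (hv : v ∈ V) (t : ℝ) : a + t • v ∈ Z :=
  (hV a ha _).2 (by simpa using V.smul_mem t hv)

lemma HasDirection.segment_subset (hV : HasDirection Z V) {p q : Fin m → ℝ} (hp : p ∈ Z)
    (hq : q ∈ Z) : segment ℝ p q ⊆ Z := by
  rw [segment_eq_image']
  rintro _ ⟨t, -, rfl⟩
  exact hV.add_smul_mem hp ((hV p hp q).1 hq) t

lemma continuous_functional (f : (Fin m → ℝ) →ₗ[ℝ] ℝ) : Continuous f :=
  f.continuous_of_finiteDimensional

lemma HasDirection.exists_lt (hV : HasDirection Z V) {f : (Fin m → ℝ) →ₗ[ℝ] ℝ}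
    (hf : ∃ v ∈ V, f v ≠ 0) {a : Fin m → ℝ} (ha : a ∈ Z) {s : Set (Fin m → ℝ)} (hs : s ∈ 𝓝 a) :
    ∃ x ∈ s, x ∈ Z ∧ f x < f a := by
  obtain ⟨v, hv, hfv⟩ := hf
  have hc : Tendsto (fun t : ℝ => a + t • (-(f v) • v)) (𝓝[>] 0) (𝓝 a) :=
    (Continuous.tendsto' (by fun_prop) _ _ (by simp)).mono_left nhdsWithin_le_nhds
  obtain ⟨t, ht, ht0⟩ := ((hc.eventually hs).and self_mem_nhdsWithin).exists
  refine ⟨_, ht, hV.add_smul_mem ha (V.smul_mem _ hv) t, ?_⟩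
  have h1 : 0 < t * (f v * f v) := mul_pos ht0 (mul_self_pos.2 hfv)
  simp only [map_add, map_smul, smul_eq_mul]
  linarith

lemma HasDirection.exists_gt (hV : HasDirection Z V) {f : (Fin m → ℝ) →ₗ[ℝ] ℝ}
    (hf : ∃ v ∈ V, f v ≠ 0) {a : Fin m → ℝ} (ha : a ∈ Z) {s : Set (Fin m → ℝ)} (hs : s ∈ 𝓝 a) :
    ∃ x ∈ s, x ∈ Z ∧ f a < f x := by
  obtain ⟨x, hxs, hxZ, hx⟩ := hV.exists_lt (f := -f) (by simpa using hf) ha hs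
  exact ⟨x, hxs, hxZ, by simpa using hx⟩

/-- The complement of finitely many hyperplanes of a flat is dense in the flat. -/
lemma HasDirection.exists_forall_ne (hV : HasDirection Z V) {ι : Type*} [Finite ι]
    {f : ι → (Fin m → ℝ) →ₗ[ℝ] ℝ} {c : ι → ℝ} (hf : ∀ i, ∃ v ∈ V, f i v ≠ 0)
    {a : Fin m → ℝ} (ha : a ∈ Z) {s : Set (Fin m → ℝ)} (hs : s ∈ 𝓝 a) :
    ∃ x ∈ s, x ∈ Z ∧ ∀ i, f i x ≠ c i := by
  have := Fintype.ofFinite ι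
  suffices h : ∀ T : Finset ι, ∃ x ∈ interior s, x ∈ Z ∧ ∀ i ∈ T, f i x ≠ c i by
    obtain ⟨x, hx, hxZ, h⟩ := h Finset.univ
    exact ⟨x, interior_subset hx, hxZ, fun i => h i (Finset.mem_univ i)⟩
  intro T
  induction T using Finset.induction_on with
  | empty => exact ⟨a, mem_interior_iff_mem_nhds.2 hs, ha, by simp⟩
  | insert i T _ ih =>
    obtain ⟨x, hx, hxZ, hxT⟩ := ih
    by_cases hi : f i x = c i
    · have hT : ∀ᶠ y in 𝓝 x, ∀ j ∈ T, f j y ≠ c j :=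
        (eventually_all_finset T).2 fun j hj =>
          (continuous_functional (f j)).continuousAt.eventually_ne (hxT j hj)
      obtain ⟨y, ⟨hy, hyT⟩, hyZ, hyi⟩ :=
        hV.exists_lt (hf i) hxZ (inter_mem (isOpen_interior.mem_nhds hx) hT)
      refine ⟨y, hy, hyZ, fun j hj => ?_⟩
      rcases Finset.mem_insert.1 hj with rfl | hj
      · exact (hi ▸ hyi).ne
      · exact hyT j hj
    · refine ⟨x, hx, hxZ, fun j hj => ?_⟩
      rcases Finset.mem_insert.1 hj with rfl | hj
      · exact hi
      · exact hxT j hj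

lemma HasDirection.bdIn_eq (hV : HasDirection Z V) {f : (Fin m → ℝ) →ₗ[ℝ] ℝ} {c : ℝ}
    {H : Set (Fin m → ℝ)} (hf : ∃ v ∈ V, f v ≠ 0) (hHZ : H ⊆ Z)
    (hlt : ∀ x ∈ Z, f x < c → x ∈ H) (hgt : ∀ x ∈ Z, c < f x → x ∉ H) :
    bdIn Z H = {a | a ∈ Z ∧ f a = c} := by
  ext a
  refine and_congr_right fun ha => ⟨fun h => ?_, fun h r hr => ?_⟩
  · by_contra hne
    rcases lt_or_gt_of_ne hne with hne | hne
    · obtain ⟨r, hr, hsub⟩ := exists_cube_subset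
        ((continuous_functional f).continuousAt.eventually_lt_const hne)
      obtain ⟨x, hx, hxZ, hxH⟩ := (h r hr).2
      exact hxH (hlt x hxZ (hsub hx))
    · obtain ⟨r, hr, hsub⟩ := exists_cube_subset
        ((continuous_functional f).continuousAt.eventually_const_lt hne)
      obtain ⟨x, hx, hxH⟩ := (h r hr).1
      exact hgt x (hHZ hxH) (hsub hx) hxH
  · subst h
    obtain ⟨x, hx, hxZ, hxa⟩ := hV.exists_lt hf ha (cube_mem_nhds a hr)
    obtain ⟨y, hy, hyZ, hya⟩ := hV.exists_gt hf ha (cube_mem_nhds a hr)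
    exact ⟨⟨x, hx, hlt x hxZ hxa⟩, ⟨y, hy, hyZ, hgt y hyZ hya⟩⟩

lemma IsHalfFlatOf.exists_functional (hV : HasDirection Z V) {H : Set (Fin m → ℝ)}
    (hH : IsHalfFlatOf Z H) :
    ∃ (f : (Fin m → ℝ) →ₗ[ℝ] ℝ) (c : ℝ), (∃ v ∈ V, f v ≠ 0) ∧
      bdIn Z H = {a | a ∈ Z ∧ f a = c} ∧ (∀ x ∈ Z, f x < c → x ∈ H) ∧
      ∀ x ∈ Z, c < f x → x ∉ H := by
  obtain ⟨⟨p, hp⟩, hne, f, c, h⟩ := hH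
  have hsub : H ⊆ Z := by rcases h with rfl | rfl <;> exact fun x hx => hx.1
  have hlt : ∀ x ∈ Z, f x < c → x ∈ H := by
    rcases h with rfl | rfl
    · exact fun x hx hlt => ⟨hx, hlt⟩
    · exact fun x hx hlt => ⟨hx, hlt.le⟩
  have hgt : ∀ x ∈ Z, c < f x → x ∉ H := by
    rcases h with rfl | rfl
    · exact fun x hx hlt hm => lt_asymm hlt hm.2
    · exact fun x hx hlt hm => hm.2.not_gt hlt
  have hf : ∃ v ∈ V, f v ≠ 0 := by
    by_contra! hf
    refine hne (hsub.antisymm fun q hq => ?_)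
    have h1 := hf _ ((hV p (hsub hp) q).1 hq)
    rw [map_sub, sub_eq_zero] at h1
    rcases h with rfl | rfl
    · exact ⟨hq, h1 ▸ hp.2⟩
    · exact ⟨hq, h1 ▸ hp.2⟩
  exact ⟨f, c, hf, hV.bdIn_eq hf hsub hlt hgt, hlt, hgt⟩

/-- Membership in a semilinear set only depends on the signs of finitely many affine functions. -/
lemma IsSemilinear.exists_functionals {E : Type*} [AddCommGroup E] [Module ℝ E] {X : Set E}
    (hX : IsSemilinear X) :
    ∃ (ι : Type) (_ : Finite ι) (f : ι → E →ₗ[ℝ] ℝ) (c : ι → ℝ), ∀ x y,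
      (∀ i, (f i x < c i ↔ f i y < c i) ∧ (f i x = c i ↔ f i y = c i)) → (x ∈ X ↔ y ∈ X) := by
  obtain ⟨N, T, hT, rfl⟩ := hX
  choose k f c rel hrel hTeq using hT
  refine ⟨Σ j, Fin (k j), inferInstance, fun i => f i.1 i.2, fun i => c i.1 i.2,
    fun x y h => ?_⟩
  simp only [Set.mem_iUnion, hTeq, Set.mem_ofPred_eq]
  refine exists_congr fun j => forall_congr' fun i => ?_
  obtain ⟨h1, h2⟩ := h ⟨j, i⟩
  rcases hrel j i with hr | hr | hr <;> rw [hr]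
  · exact h2
  · exact h1
  · simp only [le_iff_lt_or_eq]
    exact or_congr h1 h2

lemma inf_ker_lt {f : (Fin m → ℝ) →ₗ[ℝ] ℝ} (hf : ∃ v ∈ V, f v ≠ 0) :
    V ⊓ LinearMap.ker f < V := by
  obtain ⟨v, hv, hfv⟩ := hf
  exact inf_lt_left.2 fun hle => hfv (hle hv)

/-- A subset of a flat of dimension `n` covered by finitely many hyperplanes has dimension at most
`n - 1`. -/
lemma HasDirection.exists_forall_ne_of_not_sldim_le (hV : HasDirection Z V) {ι : Type*} [Finite ι]
    {f : ι → (Fin m → ℝ) →ₗ[ℝ] ℝ} {c : ι → ℝ} (hf : ∀ i, ∃ v ∈ V, f i v ≠ 0)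
    {S : Set (Fin m → ℝ)} (hSZ : S ⊆ Z)
    (hS : ¬ sldim S ≤ (((Module.finrank ℝ V : ℤ) - 1 : ℤ) : WithBot ℤ)) :
    ∃ x ∈ S, ∀ i, f i x ≠ c i := by
  by_contra! h
  refine hS (sldim_le_of_subset_iUnion (A := fun i => {x | x ∈ Z ∧ f i x = c i}) ?_ ?_)
  · intro x hx
    obtain ⟨i, hi⟩ := h x hx
    exact Set.mem_iUnion.2 ⟨i, hSZ hx, hi⟩
  · rintro i a ⟨ha, hai⟩
    refine ⟨V ⊓ LinearMap.ker (f i), ?_, ?_⟩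
    · have := Submodule.finrank_lt_finrank_of_lt (inf_ker_lt (hf i))
      omega
    · rintro x ⟨hx, hxi⟩
      exact ⟨(hV a ha x).1 hx, by simp [hxi, hai]⟩

/-- Two distinct intersecting hyperplanes of a flat meet in codimension two. -/
lemma HasDirection.finrank_inf_ker_le (hV : HasDirection Z V) {f g : (Fin m → ℝ) →ₗ[ℝ] ℝ}
    {c e : ℝ} (hf : ∃ v ∈ V, f v ≠ 0) (hg : ∃ v ∈ V, g v ≠ 0)
    (hne : {a | a ∈ Z ∧ f a = c} ≠ {a | a ∈ Z ∧ g a = e}) {a : Fin m → ℝ} (ha : a ∈ Z)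
    (hfa : f a = c) (hga : g a = e) :
    Module.finrank ℝ (V ⊓ LinearMap.ker f ⊓ LinearMap.ker g : Submodule ℝ (Fin m → ℝ)) + 2 ≤
      Module.finrank ℝ V := by
  have h1 := inf_ker_lt hf
  obtain ⟨v, hv, hfv⟩ := hf
  obtain ⟨w, hw, hgw⟩ := hg
  have h2 : V ⊓ LinearMap.ker f ⊓ LinearMap.ker g < V ⊓ LinearMap.ker f := by
    refine inf_lt_left.2 fun hker => hne ?_
    have hle : ∀ u ∈ V, f u = 0 → g u = 0 := fun u hu hfu => hker ⟨hu, hfu⟩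
    have hprop : ∀ u ∈ V, g u * f v = f u * g v := by
      intro u hu
      have := hle (f v • u - f u • v) (V.sub_mem (V.smul_mem _ hu) (V.smul_mem _ hv))
        (by simp [mul_comm])
      simp only [map_sub, map_smul, smul_eq_mul] at this
      linarith
    have hgv : g v ≠ 0 := by
      intro h0
      have := hprop w hw
      rw [h0, mul_zero, mul_eq_zero] at this
      exact this.elim hgw hfv
    ext x
    refine and_congr_right fun hx => ?_
    have := hprop _ ((hV a ha x).1 hx)
    rw [map_sub, map_sub, hfa, hga] at this
    rw [← sub_eq_zero, ← sub_eq_zero (b := e)]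
    constructor
    · intro h
      rw [h, zero_mul, mul_eq_zero] at this
      exact this.resolve_right hfv
    · intro h
      rw [h, zero_mul, eq_comm, mul_eq_zero] at this
      exact this.resolve_right hgv
  have := Submodule.finrank_lt_finrank_of_lt h1
  have := Submodule.finrank_lt_finrank_of_lt h2
  omega

lemma eventually_mem_iff_of_ne {f : (Fin m → ℝ) →ₗ[ℝ] ℝ} {c : ℝ} {H : Set (Fin m → ℝ)}
    (hlt : ∀ x ∈ Z, f x < c → x ∈ H) (hgt : ∀ x ∈ Z, c < f x → x ∉ H) {a : Fin m → ℝ}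
    (ha : a ∈ Z) (hne : f a ≠ c) :
    ∀ᶠ x in 𝓝 a, x ∈ Z → f x ≠ c ∧ (x ∈ H ↔ a ∈ H) := by
  rcases lt_or_gt_of_ne hne with h | h
  · filter_upwards [(continuous_functional f).continuousAt.eventually_lt_const h] with x hx hxZ
    exact ⟨hx.ne, iff_of_true (hlt x hxZ hx) (hlt a ha h)⟩
  · filter_upwards [(continuous_functional f).continuousAt.eventually_const_lt h] with x hx hxZ
    exact ⟨hx.ne', iff_of_false (hgt x hxZ hx) (hgt a ha h)⟩

lemma HasDirection.sldim_le (hV : HasDirection Z V) {S : Set (Fin m → ℝ)} (hS : S ⊆ Z) :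
    sldim S ≤ (((Module.finrank ℝ V : ℕ) : ℤ) : WithBot ℤ) :=
  sldim_le_of_subset_iUnion (ι := Unit) (A := fun _ => Z) (by simpa [Set.iUnion_const])
    fun _ a ha => ⟨V, le_rfl, fun x hx => (hV a ha x).1 hx⟩

lemma HasDirection.sldim_eq (hV : HasDirection Z V) {S : Set (Fin m → ℝ)} (hS : S ⊆ Z)
    {a : Fin m → ℝ} (ha : a ∈ Z) (h : ∀ᶠ x in 𝓝 a, x ∈ Z → x ∈ S) :
    sldim S = (((Module.finrank ℝ V : ℕ) : ℤ) : WithBot ℤ) :=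
  (hV.sldim_le hS).antisymm (finrank_le_sldim (h.mono fun x hx hxa => hx ((hV a ha x).2 hxa)))

end Flat

section Partition

variable {m ℓ : ℕ} {Z : Set (Fin m → ℝ)} {V : Submodule ℝ (Fin m → ℝ)}
  {H : Fin ℓ → Set (Fin m → ℝ)} {f : Fin ℓ → (Fin m → ℝ) →ₗ[ℝ] ℝ} {c : Fin ℓ → ℝ}

lemma eventually_mem_partPiece (hlt : ∀ i, ∀ x ∈ Z, f i x < c i → x ∈ H i)
    (hgt : ∀ i, ∀ x ∈ Z, c i < f i x → x ∉ H i) {J : Set (Fin ℓ)} {a : Fin m → ℝ}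
    (ha : a ∈ partPiece Z H J) (hne : ∀ i, f i a ≠ c i) :
    ∀ᶠ x in 𝓝 a, x ∈ Z → x ∈ partPiece Z H J := by
  filter_upwards [eventually_all.2 fun i =>
    eventually_mem_iff_of_ne (hlt i) (hgt i) ha.1 (hne i)] with x hx hxZ
  exact ⟨hxZ, fun i => (ha.2 i).trans (hx i hxZ).2.symm⟩

/-- If a point of a piece lies on at most one of the boundary hyperplanes, then the piece contains
a point lying on none of them. -/
lemma HasDirection.exists_mem_partPiece_forall_ne (hV : HasDirection Z V)
    (hf : ∀ i, ∃ v ∈ V, f i v ≠ 0) (hlt : ∀ i, ∀ x ∈ Z, f i x < c i → x ∈ H i)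
    (hgt : ∀ i, ∀ x ∈ Z, c i < f i x → x ∉ H i) {J : Set (Fin ℓ)} {p : Fin m → ℝ}
    (hp : p ∈ partPiece Z H J) (huniq : ∀ i j, f i p = c i → f j p = c j → i = j) :
    ∃ x ∈ partPiece Z H J, ∀ i, f i x ≠ c i := by
  by_cases hex : ∃ i, f i p = c i
  swap
  · exact ⟨p, hp, not_exists.1 hex⟩
  obtain ⟨i, hi⟩ := hex
  have hev : ∀ᶠ x in 𝓝 p, ∀ j, j ≠ i → x ∈ Z → f j x ≠ c j ∧ (x ∈ H j ↔ p ∈ H j) := by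
    refine eventually_all.2 fun j => ?_
    by_cases hj : j = i
    · simp [hj]
    filter_upwards [eventually_mem_iff_of_ne (hlt j) (hgt j) hp.1
      fun h => hj (huniq j i h hi)] with x hx _ using hx
  obtain ⟨x, hx, hxZ, hxne, hxi⟩ : ∃ x ∈ {x | ∀ j, j ≠ i → x ∈ Z → f j x ≠ c j ∧
      (x ∈ H j ↔ p ∈ H j)}, x ∈ Z ∧ f i x ≠ c i ∧ (i ∈ J ↔ x ∈ H i) := by
    by_cases hiJ : i ∈ J
    · obtain ⟨x, hx, hxZ, hxp⟩ := hV.exists_lt (hf i) hp.1 hev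
      rw [hi] at hxp
      exact ⟨x, hx, hxZ, hxp.ne, iff_of_true hiJ (hlt i x hxZ hxp)⟩
    · obtain ⟨x, hx, hxZ, hxp⟩ := hV.exists_gt (hf i) hp.1 hev
      rw [hi] at hxp
      exact ⟨x, hx, hxZ, hxp.ne', iff_of_false hiJ (hgt i x hxZ hxp)⟩
  refine ⟨x, ⟨hxZ, fun j => ?_⟩, fun j => ?_⟩
  · by_cases hj : j = i
    · exact hj ▸ hxi
    · exact (hp.2 j).trans (hx j hj hxZ).2.symm
  · by_cases hj : j = i
    · exact hj ▸ hxne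
    · exact (hx j hj hxZ).1

lemma HasDirection.sldim_partPiece (hV : HasDirection Z V)
    (hf : ∀ i, ∃ v ∈ V, f i v ≠ 0) (hlt : ∀ i, ∀ x ∈ Z, f i x < c i → x ∈ H i)
    (hgt : ∀ i, ∀ x ∈ Z, c i < f i x → x ∉ H i)
    (hne : ∀ i j, i ≠ j → {a | a ∈ Z ∧ f i a = c i} ≠ {a | a ∈ Z ∧ f j a = c j})
    (J : Set (Fin ℓ)) :
    sldim (partPiece Z H J) = (((Module.finrank ℝ V : ℕ) : ℤ) : WithBot ℤ) ∨
      sldim (partPiece Z H J) ≤ (((Module.finrank ℝ V : ℤ) - 2 : ℤ) : WithBot ℤ) := by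
  by_cases h : ∃ p ∈ partPiece Z H J, ∀ i j, f i p = c i → f j p = c j → i = j
  · left
    obtain ⟨p, hp, huniq⟩ := h
    obtain ⟨x, hx, hxne⟩ := hV.exists_mem_partPiece_forall_ne hf hlt hgt hp huniq
    exact hV.sldim_eq (fun x hx => hx.1) hx.1 (eventually_mem_partPiece hlt hgt hx hxne)
  · right
    push Not at h
    refine sldim_le_of_subset_iUnion (ι := {ij : Fin ℓ × Fin ℓ // ij.1 ≠ ij.2})
      (A := fun ij => {x | x ∈ Z ∧ f ij.1.1 x = c ij.1.1 ∧ f ij.1.2 x = c ij.1.2}) ?_ ?_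
    · intro x hx
      obtain ⟨i, j, hi, hj, hij⟩ := h x hx
      exact Set.mem_iUnion.2 ⟨⟨(i, j), hij⟩, hx.1, hi, hj⟩
    · rintro ⟨⟨i, j⟩, hij⟩ a ⟨ha, hai, haj⟩
      refine ⟨V ⊓ LinearMap.ker (f i) ⊓ LinearMap.ker (f j), ?_, ?_⟩
      · have := hV.finrank_inf_ker_le (hf i) (hf j) (hne i j hij) ha hai haj
        omega
      · rintro x ⟨hx, hxi, hxj⟩
        exact ⟨⟨(hV a ha x).1 hx, by simp_all⟩, by simp_all⟩

end Partition

section Crossing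

variable {m : ℕ} {Z : Set (Fin m → ℝ)} {V : Submodule ℝ (Fin m → ℝ)} {X : Set (Fin m → ℝ)}

lemma HasDirection.exists_nonconstant_functionals (hV : HasDirection Z V) (hX : IsSemilinear X) :
    ∃ (ι : Type) (_ : Finite ι) (f : ι → (Fin m → ℝ) →ₗ[ℝ] ℝ) (c : ι → ℝ),
      (∀ i, ∃ v ∈ V, f i v ≠ 0) ∧ ∀ x ∈ Z, ∀ y ∈ Z,
      (∀ i, (f i x < c i ↔ f i y < c i) ∧ (f i x = c i ↔ f i y = c i)) → (x ∈ X ↔ y ∈ X) := by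
  obtain ⟨ι, _, f, c, h⟩ := hX.exists_functionals
  refine ⟨{i // ∃ v ∈ V, f i v ≠ 0}, inferInstance, fun i => f i, fun i => c i, fun i => i.2,
    fun x hx y hy hxy => h x y fun i => ?_⟩
  by_cases hi : ∃ v ∈ V, f i v ≠ 0
  · exact hxy ⟨i, hi⟩
  · push Not at hi
    have h1 := hi _ ((hV x hx y).1 hy)
    rw [map_sub, sub_eq_zero] at h1
    rw [h1]
    simp

/-- A set which near `a` lies on one side of a hyperplane of the flat `Z` through `a`, up to
this hyperplane, has an essential half-flat witnessed by `a`. -/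
lemma HasDirection.exists_witnessEssential (hV : HasDirection Z V) (hXZ : X ⊆ Z)
    {g : (Fin m → ℝ) →ₗ[ℝ] ℝ} (hg : ∃ v ∈ V, g v ≠ 0) {a : Fin m → ℝ} (ha : a ∈ Z)
    {D : Set (Fin m → ℝ)} (hD : D ∈ 𝓝 a) (hlt : ∀ x ∈ D, x ∈ Z → g x < g a → x ∈ X)
    (hgt : ∀ x ∈ D, x ∈ Z → g a < g x → x ∉ X)
    (heq : ∀ x ∈ D, x ∈ Z → g x = g a → (x ∈ X ↔ a ∈ X)) :
    ∃ H, IsHalfFlatOf Z H ∧ WitnessEssential Z X H a := by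
  obtain ⟨r, hr, hrD⟩ := exists_cube_subset hD
  obtain ⟨y, -, hyZ, hy⟩ := hV.exists_lt hg ha univ_mem
  obtain ⟨z, -, hzZ, hz⟩ := hV.exists_gt hg ha univ_mem
  by_cases haX : a ∈ X
  · refine ⟨{x | x ∈ Z ∧ g x ≤ g a}, ⟨⟨y, hyZ, hy.le⟩, fun h => ?_, g, g a, Or.inr rfl⟩, ?_, r, hr,
      ?_⟩
    · exact (h.symm.subset hzZ).2.not_gt hz
    · have hbd : bdIn Z {x | x ∈ Z ∧ g x ≤ g a} = {x | x ∈ Z ∧ g x = g a} :=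
        hV.bdIn_eq hg (fun x hx => hx.1) (fun x hx h => ⟨hx, h.le⟩) fun x _ h hx => hx.2.not_gt h
      exact hbd.symm.subset ⟨ha, rfl⟩
    · ext x
      refine and_congr_left fun hx => ⟨fun h => ⟨hXZ h, ?_⟩, fun h => ?_⟩
      · exact not_lt.1 fun hlt => hgt x (hrD hx) (hXZ h) hlt h
      · rcases h.2.lt_or_eq with h' | h'
        · exact hlt x (hrD hx) h.1 h'
        · exact (heq x (hrD hx) h.1 h').2 haX
  · refine ⟨{x | x ∈ Z ∧ g x < g a}, ⟨⟨y, hyZ, hy⟩, fun h => ?_, g, g a, Or.inl rfl⟩, ?_, r, hr,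
      ?_⟩
    · exact (h.symm.subset hzZ).2.not_gt hz
    · have hbd : bdIn Z {x | x ∈ Z ∧ g x < g a} = {x | x ∈ Z ∧ g x = g a} :=
        hV.bdIn_eq hg (fun x hx => hx.1) (fun x hx h => ⟨hx, h⟩) fun x _ h hx => hx.2.not_gt h
      exact hbd.symm.subset ⟨ha, rfl⟩
    · ext x
      refine and_congr_left fun hx => ⟨fun h => ⟨hXZ h, ?_⟩, fun h => hlt x (hrD hx) h.1 h.2⟩
      rcases lt_trichotomy (g x) (g a) with h' | h' | h'
      · exact h'
      · exact absurd ((heq x (hrD hx) (hXZ h) h').1 h) haX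
      · exact absurd h (hgt x (hrD hx) (hXZ h) h')

/-- If, near `a`, membership in `X` only depends on the side of a hyperplane of `Z` through `a`,
then either `a` witnesses an essential half-flat, or `X` is locally constant around `a` off the
hyperplane. -/
lemma HasDirection.exists_witnessEssential_or (hV : HasDirection Z V) (hXZ : X ⊆ Z)
    {g : (Fin m → ℝ) →ₗ[ℝ] ℝ} (hg : ∃ v ∈ V, g v ≠ 0) {a : Fin m → ℝ} (ha : a ∈ Z)
    {D : Set (Fin m → ℝ)} (hD : D ∈ 𝓝 a)
    (h : ∀ x ∈ D, x ∈ Z → ∀ y ∈ D, y ∈ Z → (g x < g a ↔ g y < g a) → (g x = g a ↔ g y = g a) →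
      (x ∈ X ↔ y ∈ X)) :
    (∃ H, IsHalfFlatOf Z H ∧ WitnessEssential Z X H a) ∨
      (∀ x ∈ D, x ∈ Z → g x ≠ g a → x ∈ X) ∨ (∀ x ∈ D, x ∈ Z → g x ≠ g a → x ∉ X) := by
  obtain ⟨y, hyD, hyZ, hy⟩ := hV.exists_lt hg ha hD
  obtain ⟨z, hzD, hzZ, hz⟩ := hV.exists_gt hg ha hD
  have hlt : ∀ x ∈ D, x ∈ Z → g x < g a → (x ∈ X ↔ y ∈ X) := fun x hxD hxZ hx =>
    h x hxD hxZ y hyD hyZ (iff_of_true hx hy) (iff_of_false hx.ne hy.ne)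
  have hgt : ∀ x ∈ D, x ∈ Z → g a < g x → (x ∈ X ↔ z ∈ X) := fun x hxD hxZ hx =>
    h x hxD hxZ z hzD hzZ (iff_of_false hx.not_gt hz.not_gt) (iff_of_false hx.ne' hz.ne')
  have heq : ∀ x ∈ D, x ∈ Z → g x = g a → (x ∈ X ↔ a ∈ X) := fun x hxD hxZ hx =>
    h x hxD hxZ a (mem_of_mem_nhds hD) ha (by rw [hx]) (by rw [hx])
  by_cases hyX : y ∈ X <;> by_cases hzX : z ∈ X
  · refine Or.inr (Or.inl fun x hxD hxZ hx => ?_)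
    rcases lt_or_gt_of_ne hx with hx | hx
    · exact (hlt x hxD hxZ hx).2 hyX
    · exact (hgt x hxD hxZ hx).2 hzX
  · exact Or.inl (hV.exists_witnessEssential hXZ hg ha hD
      (fun x hxD hxZ hx => (hlt x hxD hxZ hx).2 hyX)
      (fun x hxD hxZ hx => fun hxX => hzX ((hgt x hxD hxZ hx).1 hxX)) heq)
  · exact Or.inl (hV.exists_witnessEssential hXZ (g := -g) (by simpa using hg) ha hD
      (fun x hxD hxZ hx => (hgt x hxD hxZ (by simpa using hx)).2 hzX)
      (fun x hxD hxZ hx => fun hxX => hyX ((hlt x hxD hxZ (by simpa using hx)).1 hxX))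
      fun x hxD hxZ hx => heq x hxD hxZ (by simpa using hx))
  · refine Or.inr (Or.inr fun x hxD hxZ hx => ?_)
    rcases lt_or_gt_of_ne hx with hx | hx
    · exact fun hxX => hyX ((hlt x hxD hxZ hx).1 hxX)
    · exact fun hxX => hzX ((hgt x hxD hxZ hx).1 hxX)

lemma exists_forall_mem_nhds_sign_eq {ι : Type*} [Finite ι] (f : ι → (Fin m → ℝ) →ₗ[ℝ] ℝ)
    (c : ι → ℝ) (a : Fin m → ℝ) :
    {x | ∀ i, f i a ≠ c i → ((f i x < c i ↔ f i a < c i) ∧ f i x ≠ c i)} ∈ 𝓝 a := by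
  refine eventually_all.2 fun i => ?_
  rcases lt_trichotomy (f i a) (c i) with h | h | h
  · filter_upwards [(continuous_functional (f i)).continuousAt.eventually_lt_const h] with x hx _
    exact ⟨iff_of_true hx h, hx.ne⟩
  · simp [h]
  · filter_upwards [(continuous_functional (f i)).continuousAt.eventually_const_lt h] with x hx _
    exact ⟨iff_of_false hx.not_gt h.not_gt, hx.ne'⟩

/-- A segment of `Z` from a point of `X` to a point of `Z \ X` that avoids the pairwise
intersections of the distinct hyperplanes defining `X` meets the boundary of an essential
half-flat. -/
lemma HasDirection.exists_witnessEssential_segment (hV : HasDirection Z V) (hXZ : X ⊆ Z)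
    {ι : Type*} [Finite ι] {f : ι → (Fin m → ℝ) →ₗ[ℝ] ℝ} {c : ι → ℝ}
    (hf : ∀ i, ∃ v ∈ V, f i v ≠ 0)
    (hfX : ∀ x ∈ Z, ∀ y ∈ Z, (∀ i, (f i x < c i ↔ f i y < c i) ∧ (f i x = c i ↔ f i y = c i)) →
      (x ∈ X ↔ y ∈ X))
    {p q : Fin m → ℝ} (hp : p ∈ X) (hpf : ∀ i, f i p ≠ c i) (hqZ : q ∈ Z) (hq : q ∉ X)
    (hqf : ∀ i, f i q ≠ c i)
    (hpq : ∀ i j, (∃ v ∈ V, (f j p - c j) * f i v - (f i p - c i) * f j v ≠ 0) →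
      (f j p - c j) * f i q - (f i p - c i) * f j q ≠
        (f j p - c j) * f i p - (f i p - c i) * f j p) :
    ∃ a ∈ segment ℝ p q, ∃ H, IsHalfFlatOf Z H ∧ WitnessEssential Z X H a := by
  by_contra! hno
  have hpZ := hXZ hp
  let U : Prop → Set (Fin m → ℝ) := fun P =>
    interior {x | x ∈ Z → (∀ i, f i x ≠ c i) → (x ∈ X ↔ P)}
  have hgeneric : ∀ a ∈ Z, (∀ i, f i a ≠ c i) → a ∈ U (a ∈ X) := by
    intro a ha hne
    refine mem_interior_iff_mem_nhds.2 (mem_of_superset (exists_forall_mem_nhds_sign_eq f c a) ?_)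
    intro x hx hxZ _
    exact hfX x hxZ a ha fun i =>
      ⟨(hx i (hne i)).1, iff_of_false (hx i (hne i)).2 (hne i)⟩
  have hcover : segment ℝ p q ⊆ U True ∪ U False := by
    intro a ha
    have haZ := hV.segment_subset hpZ hqZ ha
    by_cases hex : ∃ i, f i a = c i
    swap
    · have := hgeneric a haZ (not_exists.1 hex)
      by_cases haX : a ∈ X
      · exact Or.inl (by simpa [haX] using this)
      · exact Or.inr (by simpa [haX] using this)
    obtain ⟨i, hi⟩ := hex
    have hprop : ∀ j, f j a = c j → ∀ x ∈ Z,
        (f i p - c i) * (f j x - c j) = (f j p - c j) * (f i x - c i) := by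
      intro j hj x hx
      have hzero : ∀ v ∈ V, (f j p - c j) * f i v - (f i p - c i) * f j v = 0 := by
        by_contra! hv
        refine hpq i j hv ?_
        rw [segment_eq_image'] at ha
        obtain ⟨t, -, rfl⟩ := ha
        simp only [map_add, map_smul, map_sub, smul_eq_mul] at hi hj
        have ht : t ≠ 0 := by
          rintro rfl
          exact hpf i (by simpa using hi)
        apply mul_left_cancel₀ ht
        linear_combination (f j p - c j) * hi - (f i p - c i) * hj
      have h1 := hzero _ ((hV a haZ x).1 hx)
      rw [map_sub, map_sub, hi, hj] at h1
      linear_combination -h1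
    have hD := exists_forall_mem_nhds_sign_eq f c a
    rcases hV.exists_witnessEssential_or hXZ (hf i) haZ hD (fun x hxD hxZ y hyD hyZ h1 h2 => by
        rw [hi] at h1 h2
        refine hfX x hxZ y hyZ fun j => ?_
        by_cases hj : f j a = c j
        · have hx := hprop j hj x hxZ
          have hy := hprop j hj y hyZ
          have hip := sub_ne_zero.2 (hpf i)
          have hjp := sub_ne_zero.2 (hpf j)
          have hk : (f j p - c j) / (f i p - c i) ≠ 0 := div_ne_zero hjp hip
          have hx' : f j x - c j = (f j p - c j) / (f i p - c i) * (f i x - c i) := by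
            field_simp
            linarith
          have hy' : f j y - c j = (f j p - c j) / (f i p - c i) * (f i y - c i) := by
            field_simp
            linarith
          have h3 : c i < f i x ↔ c i < f i y := by
            rw [← not_le, ← not_le, le_iff_lt_or_eq, le_iff_lt_or_eq, h1, h2]
          refine ⟨?_, ?_⟩
          · rw [← sub_neg, ← sub_neg (b := c j), hx', hy']
            rcases lt_or_gt_of_ne hk with hk | hk
            · rw [mul_neg_iff, mul_neg_iff]
              simp [hk, hk.not_gt, h3]
            · rw [mul_neg_iff, mul_neg_iff]
              simp [hk, hk.not_gt, h1]
          · rw [← sub_eq_zero, ← sub_eq_zero (b := c j), hx', hy']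
            simp only [mul_eq_zero, hk, false_or, sub_eq_zero, h2]
        · exact ⟨(hxD j hj).1.trans (hyD j hj).1.symm,
            iff_of_false (hxD j hj).2 (hyD j hj).2⟩) with h | h | h
    · obtain ⟨H, hH, hw⟩ := h
      exact absurd hw (hno a ha H hH)
    · refine Or.inl (mem_interior_iff_mem_nhds.2 (mem_of_superset hD fun x hxD hxZ hx => ?_))
      exact iff_of_true (h x hxD hxZ (hi ▸ hx i)) trivial
    · refine Or.inr (mem_interior_iff_mem_nhds.2 (mem_of_superset hD fun x hxD hxZ hx => ?_))
      exact iff_of_false (h x hxD hxZ (hi ▸ hx i)) not_false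
  obtain ⟨a, ha, haT, haF⟩ := (convex_segment (𝕜 := ℝ) p q).isPreconnected (U True) (U False)
    isOpen_interior isOpen_interior hcover
    ⟨p, left_mem_segment ℝ p q, by simpa [hp] using hgeneric p hpZ hpf⟩
    ⟨q, right_mem_segment ℝ p q, by simpa [hq] using hgeneric q hqZ hqf⟩
  obtain ⟨x, ⟨hxT, hxF⟩, hxZ, hx⟩ := hV.exists_forall_ne hf (hV.segment_subset hpZ hqZ ha)
    (inter_mem (mem_interior_iff_mem_nhds.1 haT) (mem_interior_iff_mem_nhds.1 haF))
  exact ((hxF hxZ hx).1 ((hxT hxZ hx).2 trivial))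

end Crossing

lemma subset_fcl {E : Type*} [AddCommGroup E] [Module ℝ E] (X : Set E) : X ⊆ fcl X :=
  Set.subset_sInter fun _ hC => hC.2

/-- for every `J ⊆ [ℓ]`: (a) either `dim P_J = d` or
`dim P_J ≤ d − 2`; (b) either `dim (P_J ∩ X) ≤ d − 1` or
`dim (P_J ∖ X) ≤ d − 1`. -/
theorem essential_approx_dim {m : ℕ} (X : Set (Fin m → ℝ)) (hX : IsSemilinear X)
    (Z : Set (Fin m → ℝ)) (hZ : IsFlat Z) (hfcl : fcl X = Z) (d : ℕ)
    (hdZ : sldim Z = (d : ℤ)) (hdX : sldim X = (d : ℤ))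
    {ℓ : ℕ} (H : Fin ℓ → Set (Fin m → ℝ)) (happrox : IsEssentialApprox Z X H) :
    ∀ J : Set (Fin ℓ),
      (sldim (partPiece Z H J) = ((d : ℤ) : WithBot ℤ) ∨
        sldim (partPiece Z H J) ≤ (((d : ℤ) - 2 : ℤ) : WithBot ℤ)) ∧
      (sldim (partPiece Z H J ∩ X) ≤ (((d : ℤ) - 1 : ℤ) : WithBot ℤ) ∨
        sldim (partPiece Z H J \ X) ≤ (((d : ℤ) - 1 : ℤ) : WithBot ℤ)) := by
  obtain ⟨V, hV⟩ := hZ.exists_hasDirection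
  have hXZ : X ⊆ Z := hfcl ▸ subset_fcl X
  have hZne : Z.Nonempty := by
    rw [Set.nonempty_iff_ne_empty]
    rintro rfl
    simp [sldim] at hdZ
  have hd : Module.finrank ℝ V = d := by
    obtain ⟨a, ha⟩ := hZne
    have h := hV.sldim_eq subset_rfl ha (Eventually.of_forall fun _ h => h)
    rw [hdZ, WithBot.coe_inj] at h
    exact_mod_cast h.symm
  obtain ⟨hess, hall, hdist⟩ := happrox
  choose f c hf hbd hlt hgt using fun i => (hess i).1.exists_functional hV
  intro J
  rw [← hd]
  refine ⟨hV.sldim_partPiece hf hlt hgt (fun i j hij => ?_) J, ?_⟩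
  · rw [← hbd i, ← hbd j]
    exact hdist i j hij
  obtain ⟨ι, _, g, e, hg, hgX⟩ := hV.exists_nonconstant_functionals hX
  by_contra! hcon
  have hfg : ∀ k : Fin ℓ ⊕ ι, ∃ v ∈ V, Sum.elim f g k v ≠ 0 := by
    rintro (i | i)
    · exact hf i
    · exact hg i
  obtain ⟨p, ⟨hpJ, hpX⟩, hpne⟩ := hV.exists_forall_ne_of_not_sldim_le (c := Sum.elim c e) hfg
    (fun x hx => hx.1.1) hcon.1.not_ge
  obtain ⟨o, ⟨hoJ, hoX⟩, hone⟩ := hV.exists_forall_ne_of_not_sldim_le (c := Sum.elim c e) hfg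
    (fun x hx => hx.1.1) hcon.2.not_ge
  let h : ι × ι → (Fin m → ℝ) →ₗ[ℝ] ℝ := fun ij =>
    (g ij.2 p - e ij.2) • g ij.1 - (g ij.1 p - e ij.1) • g ij.2
  obtain ⟨q, hqnear, hqZ, hqh⟩ := hV.exists_forall_ne
    (f := fun ij : {ij : ι × ι // ∃ v ∈ V, h ij v ≠ 0} => h ij) (c := fun ij => h ij p)
    (fun ij => ij.2) hoJ.1 (exists_forall_mem_nhds_sign_eq (Sum.elim f g) (Sum.elim c e) o)
  have hqg : ∀ k, (Sum.elim f g k q < Sum.elim c e k ↔ Sum.elim f g k o < Sum.elim c e k) ∧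
      Sum.elim f g k q ≠ Sum.elim c e k := fun k => hqnear k (hone k)
  have hqX : q ∉ X := fun hq => hoX <| (hgX q hqZ o hoJ.1 fun i =>
    ⟨(hqg (Sum.inr i)).1, iff_of_false (hqg (Sum.inr i)).2 (hone (Sum.inr i))⟩).1 hq
  obtain ⟨a, ha, H', hH', hw⟩ := hV.exists_witnessEssential_segment hXZ hg hgX hpX
    (fun i => hpne (Sum.inr i)) hqZ hqX (fun i => (hqg (Sum.inr i)).2)
    fun i j hij => hqh ⟨(i, j), hij⟩
  obtain ⟨i, hi⟩ := hall H' hH' ⟨a, hw⟩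
  have hai : f i a = c i := (hbd i ▸ hi ▸ hw.1 : a ∈ {a | a ∈ Z ∧ f i a = c i}).2
  have hside : ∀ x ∈ partPiece Z H J, f i x ≠ c i → (f i x < c i ↔ i ∈ J) := by
    intro x hx hne
    rw [hx.2 i]
    refine ⟨hlt i x hx.1, fun hxi => ?_⟩
    exact lt_of_le_of_ne (not_lt.1 fun hcx => hgt i x hx.1 hcx hxi) hne
  have hpi := hside p hpJ (hpne (Sum.inl i))
  have hqi : f i q < c i ↔ i ∈ J :=
    (hqg (Sum.inl i)).1.trans (hside o hoJ (hone (Sum.inl i)))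
  by_cases hiJ : i ∈ J
  · have hconv : Convex ℝ {x | f i x < c i} := convex_halfSpace_lt (f i).isLinear _
    exact (hconv.segment_subset (hpi.2 hiJ) (hqi.2 hiJ) ha).ne hai
  · have hconv : Convex ℝ {x | c i < f i x} := convex_halfSpace_gt (f i).isLinear _
    have hp' : c i < f i p :=
      lt_of_le_of_ne (not_lt.1 (mt hpi.1 hiJ)) (hpne (Sum.inl i)).symm
    have hq' : c i < f i q :=
      lt_of_le_of_ne (not_lt.1 (mt hqi.1 hiJ)) (hqg (Sum.inl i)).2.symm
    exact (hconv.segment_subset hp' hq' ha).ne' hai
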